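/- Let N ≥ 2 be an integer, set p = N − 1, and let (x_n)_{n∈ℤ} be a sequence of nonzero rational numbers satisfying x_{n+N}·x_n = x_{n+N−1}·x_{n+1} + (x_{n+1} + x_{n+2} + … + x_{n+N−1}) for all n ∈ ℤ, with initial data x_i = 1 for i = 0, 1, …, p. Then for all n ∈ ℤ, x_{n+3p} − (F_{2p+2} + p·F_{2p} − F_{2p−2} + 1)·(x_{n+2p} − x_{n+p}) − x_n = 0, where F_m denotes the m-th Fibonacci number (F_0 = 0, F_1 = 1). -/

import Mathlib

theorem aux_tel (x : ℤ → ℚ) (n : ℤ) (q : ℕ) :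
    ∑ i ∈ Finset.Ico 1 (q + 2), x (n + 1 + (i : ℤ)) =
      ∑ i ∈ Finset.Ico 1 (q + 2), x (n + (i : ℤ)) + x (n + q + 2) - x (n + 1) := by
  induction q with
  | zero => simp [add_assoc]
  | succ q ih =>
    rw [Finset.sum_Ico_succ_top (by omega), ih, Finset.sum_Ico_succ_top (b := q + 2) (by omega)]
    push_cast
    rw [show n + 1 + ((q : ℤ) + 2) = n + (q + 1) + 2 by ring,
      show n + ((q : ℤ) + 2) = n + q + 2 by ring]
    ring

theorem aux_fib (k : ℕ) : (Nat.fib (2 * k + 4) : ℚ) = 3 * Nat.fib (2 * k + 2) - Nat.fib (2 * k) := by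
  have h1 : Nat.fib (2 * k + 2) = _ := Nat.fib_add_two
  have h2 : Nat.fib (2 * k + 3) = _ := Nat.fib_add_two (n := 2 * k + 1)
  have h3 : Nat.fib (2 * k + 4) = _ := Nat.fib_add_two (n := 2 * k + 2)
  rw [h3, h2, h1]
  push_cast
  ring

theorem aux_det (k : ℕ) : (Nat.fib (2 * k) : ℚ) ^ 2 - 3 * Nat.fib (2 * k) * Nat.fib (2 * k + 2)
    + (Nat.fib (2 * k + 2) : ℚ) ^ 2 = 1 := by
  induction k with
  | zero => simp
  | succ k ih =>
    have h := aux_fib k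
    rw [show 2 * (k + 1) + 2 = 2 * k + 4 by ring, show 2 * (k + 1) = 2 * k + 2 by ring, h]
    linear_combination ih

theorem aux_sol (J y : ℤ → ℚ) (q : ℕ) (hy : ∀ n, y (n + 2) = J n * y (n + 1) - y n)
    (hJ : ∀ k : ℕ, k < q → J k = 3) (k : ℕ) (hk : k ≤ q) :
    y k = y 1 * Nat.fib (2 * k) - y 0 * (3 * Nat.fib (2 * k) - Nat.fib (2 * k + 2)) ∧
    y (k + 1) = y 1 * Nat.fib (2 * k + 2) - y 0 * Nat.fib (2 * k) := by
  induction k with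
  | zero => simp
  | succ k ih =>
    obtain ⟨h1, h2⟩ := ih (by omega)
    have h := aux_fib k
    have h3 := hy k
    rw [hJ k (by omega)] at h3
    rw [show 2 * (k + 1) + 2 = 2 * k + 4 by ring, show 2 * (k + 1) = 2 * k + 2 by ring, h]
    push_cast
    rw [show (k : ℤ) + 1 + 1 = k + 2 by ring]
    constructor
    · rw [h2]; ring
    · rw [h3, h1, h2]; ring

theorem aux_zero (J e : ℤ → ℚ) (he : ∀ n, e (n + 2) = J n * e (n + 1) - e n)
    (h0 : e 0 = 0) (h1 : e 1 = 0) (n : ℤ) : e n = 0 := by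
  suffices h : e n = 0 ∧ e (n + 1) = 0 from h.1
  induction n using Int.induction_on with
  | zero => simpa using ⟨h0, h1⟩
  | succ i ih =>
    refine ⟨ih.2, ?_⟩
    rw [show (i : ℤ) + 1 + 1 = i + 2 by ring, he, ih.1, ih.2]; ring
  | pred i ih =>
    have h := he (-(i : ℤ) - 1)
    rw [show -(i : ℤ) - 1 + 2 = -i + 1 by ring, show -(i : ℤ) - 1 + 1 = -i by ring,
      ih.1, ih.2] at h
    rw [show -(i : ℤ) - 1 + 1 = -i by ring]
    exact ⟨by linarith, ih.1⟩

/-- Proposition 1.2: with `p = N-1`, the iterates of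
`x_{n+N} x_n = x_{n+N-1} x_{n+1} + (x_{n+1} + ⋯ + x_{n+N-1})` with all `N` initial values
equal to `1` satisfy
`x_{n+3p} - (F_{2p+2} + p F_{2p} - F_{2p-2} + 1)(x_{n+2p} - x_{n+p}) - x_n = 0`,
where `F_m` is the `m`-th Fibonacci number. -/
theorem ones_linear_relation (N : ℕ) (hN : 2 ≤ N) (p : ℕ) (hp : p = N - 1)
    (x : ℤ → ℚ) (hx : ∀ n : ℤ, x n ≠ 0)
    (hrec : ∀ n : ℤ, x (n + N) * x n =
      x (n + N - 1) * x (n + 1) + ∑ i ∈ Finset.Ico 1 N, x (n + (i : ℤ)))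
    (hinit : ∀ i : ℕ, i ≤ p → x (i : ℤ) = 1) :
    ∀ n : ℤ, x (n + 3 * (p : ℤ)) -
      ((Nat.fib (2 * p + 2) : ℚ) + p * Nat.fib (2 * p) - Nat.fib (2 * p - 2) + 1) *
        (x (n + 2 * (p : ℤ)) - x (n + (p : ℤ))) - x n = 0 := by
  obtain ⟨q, rfl⟩ : ∃ q, N = q + 2 := ⟨N - 2, by omega⟩
  obtain rfl : p = q + 1 := by omega
  set J : ℤ → ℚ := fun n => (x (n + 2) + x n + 1) / x (n + 1) with hJdef
  have hJx : ∀ n, x (n + 2) = J n * x (n + 1) - x n - 1 := by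
    intro n
    have := hx (n + 1)
    simp only [hJdef]
    field_simp
    ring
  have hper : ∀ n, J (n + (q + 1)) = J n := by
    intro n
    have a1 := hrec n
    have a2 := hrec (n + 1)
    rw [aux_tel] at a2
    push_cast at a1 a2
    rw [show n + ((q : ℤ) + 2) - 1 = n + q + 1 by ring,
      show n + ((q : ℤ) + 2) = n + q + 2 by ring] at a1
    rw [show n + 1 + ((q : ℤ) + 2) - 1 = n + q + 2 by ring,
      show n + 1 + ((q : ℤ) + 2) = n + q + 3 by ring,
      show n + 1 + 1 = n + 2 by ring] at a2
    have b1 := hx (n + 1)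
    have b2 := hx (n + q + 2)
    simp only [hJdef]
    rw [show n + ((q : ℤ) + 1) + 2 = n + q + 3 by ring,
      show n + ((q : ℤ) + 1) + 1 = n + q + 2 by ring,
      show n + ((q : ℤ) + 1) = n + q + 1 by ring, div_eq_div_iff b2 b1]
    linear_combination a2 - a1
  have hJ3 : ∀ k : ℕ, k < q → J k = 3 := by
    intro k hk
    have c0 := hinit k (by omega)
    have c1 := hinit (k + 1) (by omega)
    have c2 := hinit (k + 2) (by omega)
    push_cast at c1 c2
    simp only [hJdef]
    rw [c0, c1, c2]; norm_num
  have hJq : J q = q + 4 := by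
    have c0 := hinit q (by omega)
    have c1 := hinit (q + 1) (by omega)
    have c2 := hrec 0
    have d0 := hinit 0 (by omega)
    have d1 := hinit 1 (by omega)
    have hs : ∑ i ∈ Finset.Ico 1 (q + 2), x (0 + (i : ℤ)) = q + 1 := by
      rw [Finset.sum_congr rfl (g := fun _ => (1 : ℚ))]
      · simp
      · intro i hi
        rw [Finset.mem_Ico] at hi
        rw [zero_add]
        exact hinit i (by omega)
    rw [hs] at c2
    push_cast at c1 c2 d0 d1
    rw [show (0 : ℤ) + ((q : ℤ) + 2) - 1 = q + 1 by ring,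
      show (0 : ℤ) + ((q : ℤ) + 2) = q + 2 by ring, d0, d1, c1] at c2
    simp only [hJdef]
    rw [c0, c1]
    linarith
  set P : ℤ := (q : ℤ) + 1 with hP
  set d : ℤ → ℚ := fun n => x (n + P) - x n with hd
  have hdr : ∀ n, d (n + 2) = J n * d (n + 1) - d n := by
    intro n
    have h1 := hJx n
    have h2 := hJx (n + P)
    rw [hper, show n + P + 2 = n + 2 + P by ring, show n + P + 1 = n + 1 + P by ring] at h2
    simp only [hd]
    rw [h1, h2]; ring
  have hshift : ∀ y : ℤ → ℚ, (∀ n, y (n + 2) = J n * y (n + 1) - y n) →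
      ∀ n, y (n + 2 + P) = J n * y (n + 1 + P) - y (n + P) := by
    intro y hy n
    have h2 := hy (n + P)
    rwa [hper, show n + P + 2 = n + 2 + P by ring, show n + P + 1 = n + 1 + P by ring] at h2
  have hmono : ∀ y : ℤ → ℚ, (∀ n, y (n + 2) = J n * y (n + 1) - y n) →
      y P = y 1 * Nat.fib (2 * q + 2) - y 0 * Nat.fib (2 * q) ∧
      y (1 + P) = (q + 4) * (y 1 * Nat.fib (2 * q + 2) - y 0 * Nat.fib (2 * q)) -
        (y 1 * Nat.fib (2 * q) - y 0 * (3 * Nat.fib (2 * q) - Nat.fib (2 * q + 2))) := by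
    intro y hy
    obtain ⟨h1, h2⟩ := aux_sol J y q hy hJ3 q le_rfl
    have h3 := hy q
    rw [hJq, h1, h2] at h3
    refine ⟨h2, ?_⟩
    rw [← h3, hP]
    congr 1; ring
  have hdP := hshift d hdr
  have hdPP := hshift (fun n => d (n + P)) hdP
  obtain ⟨m1, m2⟩ := hmono d hdr
  obtain ⟨m3, m4⟩ := hmono (fun n => d (n + P)) hdP
  have hdet := aux_det q
  have hfib := aux_fib q
  simp only [zero_add] at m3 m4
  rw [m2, m1] at m3 m4
  set a : ℚ := (Nat.fib (2 * q) : ℚ) with ha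
  set b : ℚ := (Nat.fib (2 * q + 2) : ℚ) with hb
  set T : ℚ := (3 * b - a) + (q + 1) * b - a with hT
  have key := aux_zero J (fun n => d (n + P + P) - T * d (n + P) + d n)
    (by
      intro n
      beta_reduce
      have e1 := hdPP n
      rw [e1, hdP, hdr]; ring)
    (by
      simp only [zero_add]
      rw [m3, m1, hT]
      linear_combination (-d 0) * hdet)
    (by
      beta_reduce
      rw [m4, m2, hT]
      linear_combination (-d 1) * hdet)
  intro n
  have k := key n
  simp only [hd] at k
  rw [show 2 * (q + 1) + 2 = 2 * q + 4 by ring, show 2 * (q + 1) - 2 = 2 * q by omega,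
    show 2 * (q + 1) = 2 * q + 2 by ring, hfib]
  push_cast
  rw [← hP, show n + 3 * P = n + P + P + P by ring, show n + 2 * P = n + P + P by ring]
  rw [hT] at k
  linear_combination k
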